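/- Let f be a holomorphic function on the unit disk 𝔻 with sup_{ζ∈𝔻} |Re f(ζ)| < ∞. Then for every integer n ≥ 1 and every z ∈ 𝔻, |f^(n)(z)| ≤ (4·n!·sup_{ζ∈𝔻}|Re f(ζ)|/π) · 1/((1 − |z|)^n · (1 + |z|)). -/

import Mathlib

open Complex Metric Set

theorem integral_abs_cos_mul_add {k : ℕ} (hk : k ≠ 0) (t : ℝ) :
    ∫ θ in (0 : ℝ)..2 * Real.pi, |Real.cos (k * θ + t)| = 4 := by
  have hk' : (k : ℝ) ≠ 0 := by exact_mod_cast hk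
  have hper : Function.Periodic (fun x => |Real.cos x|) Real.pi := fun x => by
    simp [Real.cos_add_pi]
  have hcont : Continuous fun x => |Real.cos x| := Real.continuous_cos.abs
  have hone : ∫ x in t..t + Real.pi, |Real.cos x| = 2 := by
    rw [hper.intervalIntegral_add_eq t (-(Real.pi / 2)),
      show -(Real.pi / 2) + Real.pi = Real.pi / 2 by ring,
      intervalIntegral.integral_congr (g := Real.cos), integral_cos]
    · simp; norm_num
    · intro x hx
      rw [uIcc_of_le (by linarith [Real.pi_pos])] at hx
      exact abs_of_nonneg (Real.cos_nonneg_of_mem_Icc hx)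
  have hmul := hper.intervalIntegral_add_zsmul_eq (2 * k : ℕ) t
    fun _ _ => hcont.intervalIntegrable _ _
  rw [intervalIntegral.integral_comp_mul_add (fun x => |Real.cos x|) hk' t]
  simp only [hone, zsmul_eq_mul] at hmul
  push_cast at hmul
  rw [show k * 0 + t = t by ring,
    show (k : ℝ) * (2 * Real.pi) + t = t + 2 * k * Real.pi by ring, hmul, smul_eq_mul]
  field_simp
  norm_num

/-- The Taylor coefficients of `g` as integrals against a cosine. -/
theorem integral_mul_cos_eq {g : ℂ → ℂ} {R : ℝ} (hR : 0 < R)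
    (hg : DiffContOnCl ℂ g (ball 0 R)) {k : ℕ} (hk : k ≠ 0) :
    ∫ θ in (0 : ℝ)..2 * Real.pi,
      g (circleMap 0 R θ) * (Real.cos (k * θ + arg (iteratedDeriv k g 0)) : ℝ) =
      Real.pi * R ^ k * ‖iteratedDeriv k g 0‖ / k.factorial := by
  set D := iteratedDeriv k g 0 with hD
  have hRc : (R : ℂ) ≠ 0 := by exact_mod_cast hR.ne'
  have hcm (θ : ℝ) : circleMap 0 R θ = R * cexp (θ * I) := by simp [circleMap]
  have hgc : Continuous fun θ : ℝ => g (circleMap 0 R θ) := by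
    refine hg.continuousOn_ball.comp_continuous (continuous_circleMap 0 R) fun θ => ?_
    exact circleMap_mem_closedBall 0 hR.le θ
  have hA : ∫ θ in (0 : ℝ)..2 * Real.pi, g (circleMap 0 R θ) * cexp (-(k * θ * I)) =
      2 * Real.pi * R ^ k * D / k.factorial := by
    have h := hg.circleIntegral_one_div_sub_center_pow_smul hR k
    rw [circleIntegral, intervalIntegral.integral_congr
      (g := fun θ => (I / R ^ k) * (g (circleMap 0 R θ) * cexp (-(k * θ * I)))),
      intervalIntegral.integral_const_mul] at h
    · rw [smul_eq_mul] at h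
      have hR' : (R : ℂ) ^ k ≠ 0 := pow_ne_zero k hRc
      rw [← mul_right_inj' (div_ne_zero I_ne_zero hR'), h, ← hD]
      field_simp
    · intro θ _
      simp only [deriv_circleMap, smul_eq_mul, sub_zero, hcm]
      rw [exp_neg, mul_assoc (k : ℂ), exp_nat_mul]
      field_simp [exp_ne_zero]
      ring
  have hB : ∫ θ in (0 : ℝ)..2 * Real.pi, g (circleMap 0 R θ) * cexp (k * θ * I) = 0 := by
    have hd : DiffContOnCl ℂ (fun w : ℂ => w ^ (k - 1) • g w) (ball 0 R) :=
      (differentiable_id.pow (k - 1)).diffContOnCl.smul hg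
    have h := hd.circleIntegral_eq_zero hR.le
    rw [circleIntegral, intervalIntegral.integral_congr
      (g := fun θ => (I * R ^ k) * (g (circleMap 0 R θ) * cexp (k * θ * I))),
      intervalIntegral.integral_const_mul] at h
    · simpa [hRc, hk] using h
    · intro θ _
      simp only [deriv_circleMap, smul_eq_mul, hcm]
      rw [mul_assoc (k : ℂ), exp_nat_mul]
      obtain ⟨m, rfl⟩ := Nat.exists_eq_succ_of_ne_zero hk
      simp only [Nat.succ_eq_add_one, Nat.add_sub_cancel]
      ring
  have hsplit (θ : ℝ) : g (circleMap 0 R θ) * (Real.cos (k * θ + arg D) : ℝ) =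
      cexp (arg D * I) / 2 * (g (circleMap 0 R θ) * cexp (k * θ * I)) +
      cexp (-(arg D * I)) / 2 * (g (circleMap 0 R θ) * cexp (-(k * θ * I))) := by
    push_cast
    rw [Complex.cos, show ((k : ℂ) * θ + arg D) * I = k * θ * I + arg D * I by ring,
      show -((k : ℂ) * θ + arg D) * I = -(k * θ * I) + -(arg D * I) by ring, exp_add, exp_add]
    ring
  have hphase : cexp (-(arg D * I)) * D = ‖D‖ := by
    nth_rw 2 [← norm_mul_exp_arg_mul_I D]
    rw [exp_neg]
    field_simp [exp_ne_zero]
  simp_rw [hsplit]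
  rw [intervalIntegral.integral_add
      ((continuous_const.fun_mul (hgc.fun_mul (by fun_prop))).intervalIntegrable _ _)
      ((continuous_const.fun_mul (hgc.fun_mul (by fun_prop))).intervalIntegrable _ _),
    intervalIntegral.integral_const_mul, intervalIntegral.integral_const_mul, hA, hB, ← hphase]
  ring

theorem norm_iteratedDeriv_le_of_abs_re_le_of_diffContOnCl {g : ℂ → ℂ} {R M : ℝ} (hR : 0 < R)
    (hg : DiffContOnCl ℂ g (ball 0 R)) (hM : ∀ w ∈ sphere (0 : ℂ) R, |(g w).re| ≤ M)
    {k : ℕ} (hk : k ≠ 0) :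
    R ^ k * ‖iteratedDeriv k g 0‖ ≤ k.factorial * (4 * M / Real.pi) := by
  have hgc : Continuous fun θ : ℝ => g (circleMap 0 R θ) := by
    refine hg.continuousOn_ball.comp_continuous (continuous_circleMap 0 R) fun θ => ?_
    exact circleMap_mem_closedBall 0 hR.le θ
  have h := congrArg re (integral_mul_cos_eq hR hg hk)
  set t := arg (iteratedDeriv k g 0)
  rw [← reCLM_apply, ← reCLM.intervalIntegral_comp_comm
    ((hgc.fun_mul (by fun_prop)).intervalIntegrable _ _)] at h
  simp only [reCLM_apply, re_mul_ofReal] at h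
  have hre : (Real.pi * R ^ k * ‖iteratedDeriv k g 0‖ / k.factorial : ℂ).re =
      Real.pi * R ^ k * ‖iteratedDeriv k g 0‖ / k.factorial := by
    rw [← ofReal_re (Real.pi * R ^ k * ‖iteratedDeriv k g 0‖ / k.factorial)]
    push_cast
    rfl
  have hle : ∫ θ in (0 : ℝ)..2 * Real.pi, (g (circleMap 0 R θ)).re * Real.cos (k * θ + t) ≤
      ∫ θ in (0 : ℝ)..2 * Real.pi, M * |Real.cos (k * θ + t)| := by
    refine intervalIntegral.integral_mono_on Real.two_pi_pos.le
      (((continuous_re.comp hgc).mul (by fun_prop)).intervalIntegrable _ _)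
      (Continuous.intervalIntegrable (by fun_prop) _ _) fun θ _ => ?_
    refine (le_abs_self _).trans ?_
    rw [abs_mul]
    exact mul_le_mul_of_nonneg_right (hM _ (circleMap_mem_sphere 0 hR.le θ)) (abs_nonneg _)
  rw [h, hre, intervalIntegral.integral_const_mul, integral_abs_cos_mul_add hk,
    div_le_iff₀ (by positivity)] at hle
  rw [← mul_div_assoc, le_div_iff₀ Real.pi_pos]
  linarith

/-- Taylor coefficients of a holomorphic function on the unit disk with bounded real part. -/
theorem norm_iteratedDeriv_zero_le_of_abs_re_le {g : ℂ → ℂ} {M : ℝ}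
    (hg : DifferentiableOn ℂ g (ball 0 1)) (hM : ∀ w ∈ ball (0 : ℂ) 1, |(g w).re| ≤ M)
    {k : ℕ} (hk : k ≠ 0) :
    ‖iteratedDeriv k g 0‖ ≤ k.factorial * (4 * M / Real.pi) := by
  have hlim : Filter.Tendsto (fun R : ℝ => R ^ k * ‖iteratedDeriv k g 0‖)
      (nhdsWithin 1 (Iio 1)) (nhds (1 ^ k * ‖iteratedDeriv k g 0‖)) :=
    (Continuous.tendsto (by fun_prop) 1).mono_left nhdsWithin_le_nhds
  rw [one_pow, one_mul] at hlim
  refine le_of_tendsto hlim ?_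
  filter_upwards [Ioo_mem_nhdsLT (zero_lt_one' ℝ)] with R hR
  exact norm_iteratedDeriv_le_of_abs_re_le_of_diffContOnCl hR.1
    (hg.diffContOnCl_ball (closedBall_subset_ball hR.2))
    (fun w hw => hM w (sphere_subset_closedBall.trans (closedBall_subset_ball hR.2) hw)) hk

theorem lah_coeff_succ (n j : ℕ) :
    (n + 2 : ℂ) * ((n + 1).choose (j + 1) / (j + 2).factorial) =
      (n + 3 + j) * (n.choose (j + 1) / (j + 2).factorial) +
        n.choose j / (j + 1).factorial := by
  have h : (n.choose (j + 1) : ℂ) * (j + 1) = n.choose j * (n - j) := by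
    rcases le_or_gt j n with hj | hj
    · have := congrArg (Nat.cast (R := ℂ)) (Nat.choose_succ_right_eq n j)
      push_cast [Nat.cast_sub hj] at this
      exact this
    · simp [Nat.choose_eq_zero_of_lt hj, Nat.choose_eq_zero_of_lt (hj.trans (Nat.lt_succ_self j))]
  have hj2 : (j + 2 : ℂ) ≠ 0 := by exact_mod_cast (Nat.succ_ne_zero (j + 1))
  have hfac : ((j + 1).factorial : ℂ) ≠ 0 := by exact_mod_cast (j + 1).factorial_ne_zero
  rw [Nat.choose_succ_succ, Nat.factorial_succ (j + 1)]
  push_cast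
  rw [show (j : ℂ) + 1 + 1 = j + 2 by ring]
  field_simp
  linear_combination -h

/-- The recursion satisfied by the Lah-type sums in `iteratedDeriv_comp_of_riccati`. -/
theorem lah_sum_succ (X : ℕ → ℂ) (a c : ℂ) (n : ℕ) :
    ((n + 1).factorial / a ^ (n + 1)) * ∑ j ∈ Finset.range (n + 1),
      (n.choose j / (j + 1).factorial) * c ^ (n - j) *
        (((n + 2 + j) * c * X j + X (j + 1)) / a) =
    ((n + 1 + 1).factorial / a ^ (n + 1 + 1)) * ∑ j ∈ Finset.range (n + 1 + 1),
      ((n + 1).choose j / (j + 1).factorial) * c ^ (n + 1 - j) * X j := by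
  have hL : ∑ j ∈ Finset.range (n + 1), (n.choose j / (j + 1).factorial) * c ^ (n - j) *
        (((n + 2 + j) * c * X j + X (j + 1)) / a) =
      (∑ j ∈ Finset.range (n + 1 + 1),
          (n + 2 + j) * (n.choose j / (j + 1).factorial) * c ^ (n + 1 - j) * X j +
        ∑ j ∈ Finset.range (n + 1),
          (n.choose j / (j + 1).factorial) * c ^ (n - j) * X (j + 1)) / a := by
    rw [Finset.sum_range_succ _ (n + 1), Nat.choose_succ_self, Nat.cast_zero, zero_div, mul_zero,
      zero_mul, zero_mul, add_zero, ← Finset.sum_add_distrib, Finset.sum_div]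
    refine Finset.sum_congr rfl fun j hj => ?_
    rw [Nat.succ_sub (Nat.lt_succ_iff.mp (Finset.mem_range.mp hj)), pow_succ]
    ring
  have hR : (∑ j ∈ Finset.range (n + 1 + 1),
          (n + 2 + j) * (n.choose j / (j + 1).factorial) * c ^ (n + 1 - j) * X j +
        ∑ j ∈ Finset.range (n + 1),
          (n.choose j / (j + 1).factorial) * c ^ (n - j) * X (j + 1)) =
      (n + 2) * ∑ j ∈ Finset.range (n + 1 + 1),
        ((n + 1).choose j / (j + 1).factorial) * c ^ (n + 1 - j) * X j := by
    rw [Finset.sum_range_succ', Finset.sum_range_succ' _ (n + 1), add_right_comm,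
      ← Finset.sum_add_distrib, mul_add, Finset.mul_sum]
    congr 1
    · refine Finset.sum_congr rfl fun j _ => ?_
      rw [Nat.add_sub_add_right]
      push_cast
      linear_combination -(c ^ (n - j) * X (j + 1)) * lah_coeff_succ n j
    · simp
      ring
  rw [hL, hR, Nat.factorial_succ (n + 1), pow_succ a (n + 1)]
  push_cast
  ring

/-- Iterated derivatives of `g ∘ ψ`, where `ψ` solves the Riccati equation
`ψ' = (1 + c ψ)² / a` satisfied by a Möbius transformation. -/
theorem iteratedDeriv_comp_of_riccati {f g ψ : ℂ → ℂ} {a c : ℂ} {U V : Set ℂ}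
    (hU : IsOpen U) (hV : IsOpen V) (hg : DifferentiableOn ℂ g V) (hψV : MapsTo ψ U V)
    (hψ : ∀ ζ ∈ U, HasDerivAt ψ ((1 + c * ψ ζ) ^ 2 / a) ζ) (hf : EqOn f (g ∘ ψ) U) (n : ℕ) :
    ∀ ζ ∈ U, iteratedDeriv (n + 1) f ζ =
      ((n + 1).factorial / a ^ (n + 1)) * ∑ j ∈ Finset.range (n + 1),
        (n.choose j / (j + 1).factorial) * c ^ (n - j) *
          ((1 + c * ψ ζ) ^ (n + 2 + j) * iteratedDeriv (j + 1) g (ψ ζ)) := by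
  have hgi (m : ℕ) : ∀ ζ ∈ U, HasDerivAt (fun x => iteratedDeriv m g (ψ x))
      (iteratedDeriv (m + 1) g (ψ ζ) * ((1 + c * ψ ζ) ^ 2 / a)) ζ := by
    intro ζ hζ
    have hd : DifferentiableAt ℂ (iteratedDeriv m g) (ψ ζ) := by
      rw [iteratedDeriv_eq_iterate]
      exact ((hg.analyticOnNhd hV).iterated_deriv m _ (hψV hζ)).differentiableAt
    rw [iteratedDeriv_succ]
    exact hd.hasDerivAt.comp ζ (hψ ζ hζ)
  have hev {F G : ℂ → ℂ} (h : EqOn F G U) {ζ : ℂ} (hζ : ζ ∈ U) : F =ᶠ[nhds ζ] G :=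
    h.eventuallyEq_of_mem (hU.mem_nhds hζ)
  induction n with
  | zero =>
    intro ζ hζ
    rw [zero_add, iteratedDeriv_one, (hev hf hζ).deriv_eq]
    have := (hgi 0 ζ hζ).deriv
    simp only [iteratedDeriv_zero] at this
    rw [Function.comp_def, this]
    simp
    ring
  | succ n ih =>
    intro ζ hζ
    rw [iteratedDeriv_succ, (hev ih hζ).deriv_eq]
    have hterm (j : ℕ) : HasDerivAt
        (fun x => (1 + c * ψ x) ^ (n + 2 + j) * iteratedDeriv (j + 1) g (ψ x))
        (((n + 2 + j) * c * ((1 + c * ψ ζ) ^ (n + 3 + j) * iteratedDeriv (j + 1) g (ψ ζ)) +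
          (1 + c * ψ ζ) ^ (n + 3 + (j + 1)) * iteratedDeriv (j + 2) g (ψ ζ)) / a) ζ := by
      refine ((((hψ ζ hζ).const_mul c).const_add 1).fun_pow (n + 2 + j)).fun_mul
        (hgi (j + 1) ζ hζ) |>.congr_deriv ?_
      rw [show n + 2 + j - 1 = n + 1 + j by omega]
      push_cast
      ring
    rw [((HasDerivAt.fun_sum fun j _ => (hterm j).const_mul
      ((n.choose j / (j + 1).factorial) * c ^ (n - j))).const_mul _).deriv]
    generalize hX : (fun j => (1 + c * ψ ζ) ^ (n + 3 + j) * iteratedDeriv (j + 1) g (ψ ζ)) = X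
    replace hX (j : ℕ) : (1 + c * ψ ζ) ^ (n + 3 + j) * iteratedDeriv (j + 1) g (ψ ζ) = X j :=
      congrFun hX j
    rw [show n + 1 + 2 = n + 3 from rfl]
    simp only [hX]
    exact lah_sum_succ X a c n

theorem one_sub_conj_mul_ne_zero {z w : ℂ} (hz : ‖z‖ < 1) (hw : ‖w‖ < 1) :
    1 - (starRingEnd ℂ) z * w ≠ 0 := by
  intro h
  have h1 : ‖(starRingEnd ℂ) z * w‖ = 1 := by rw [← sub_eq_zero.mp h, norm_one]
  rw [norm_mul, RCLike.norm_conj] at h1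
  nlinarith [norm_nonneg z, norm_nonneg w]

theorem norm_mobius_lt_one {z w : ℂ} (hz : ‖z‖ < 1) (hw : ‖w‖ < 1) :
    ‖(w - z) / (1 - (starRingEnd ℂ) z * w)‖ < 1 := by
  have hne := one_sub_conj_mul_ne_zero hz hw
  rw [norm_div, div_lt_one (norm_pos_iff.mpr hne)]
  refine lt_of_pow_lt_pow_left₀ 2 (norm_nonneg _) ?_
  have hz2 : ‖z‖ ^ 2 < 1 := by nlinarith [norm_nonneg z]
  have hw2 : ‖w‖ ^ 2 < 1 := by nlinarith [norm_nonneg w]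
  have hpos := mul_pos (sub_pos.mpr hz2) (sub_pos.mpr hw2)
  simp only [← normSq_eq_norm_sq, normSq_apply, sub_re, sub_im, mul_re, mul_im, conj_re, conj_im,
    one_re, one_im] at hpos ⊢
  nlinarith [hpos]

/-- If `f` is holomorphic on the unit disk and `sup_{ζ∈𝔻} |Re f(ζ)| < ∞`, then for
every `n ≥ 1` and `z` in the disk,
`|f⁽ⁿ⁾(z)| ≤ 4·n!·sup|Re f| / (π·(1-|z|)ⁿ·(1+|z|))`. -/
theorem deriv_bound_of_re_bounded
    (f : ℂ → ℂ)
    (hf : DifferentiableOn ℂ f (ball (0 : ℂ) 1))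
    (hbdd : BddAbove ((fun ζ => |(f ζ).re|) '' ball (0 : ℂ) 1)) :
    ∀ n : ℕ, 1 ≤ n → ∀ z ∈ ball (0 : ℂ) 1,
      ‖iteratedDeriv n f z‖ ≤
        4 * n.factorial * sSup ((fun ζ => |(f ζ).re|) '' ball (0 : ℂ) 1) /
          (Real.pi * (1 - ‖z‖) ^ n * (1 + ‖z‖)) := by
  intro n hn z hz
  obtain ⟨m, rfl⟩ := Nat.exists_eq_add_of_le' hn
  set M := sSup ((fun ζ => |(f ζ).re|) '' ball (0 : ℂ) 1)
  have hM : ∀ ζ ∈ ball (0 : ℂ) 1, |(f ζ).re| ≤ M := fun ζ hζ =>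
    le_csSup hbdd (mem_image_of_mem _ hζ)
  have hM0 : 0 ≤ M := (abs_nonneg _).trans (hM z hz)
  have hz1 : ‖z‖ < 1 := by simpa using hz
  set c := (starRingEnd ℂ) z with hc
  have hcz : c * z = (‖z‖ ^ 2 : ℝ) := by rw [hc, conj_mul']; norm_cast
  have ha : (1 - ‖z‖ ^ 2 : ℝ) ≠ 0 := by nlinarith [norm_nonneg z]
  have ha' : (1 - c * z) ≠ 0 := by rw [hcz]; exact_mod_cast ha
  let φ : ℂ → ℂ := fun w => (w + z) / (1 + c * w)
  let ψ : ℂ → ℂ := fun ζ => (ζ - z) / (1 - c * ζ)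
  have hψ1 : MapsTo ψ (ball 0 1) (ball 0 1) := fun ζ hζ => by
    rw [mem_ball_zero_iff] at hζ ⊢
    exact norm_mobius_lt_one hz1 hζ
  have hφne {w : ℂ} (hw : w ∈ ball (0 : ℂ) 1) : 1 + c * w ≠ 0 := by
    simpa [hc] using one_sub_conj_mul_ne_zero (z := -z) (by simpa using hz1)
      (mem_ball_zero_iff.mp hw)
  have hφ1 : MapsTo φ (ball 0 1) (ball 0 1) := fun w hw => by
    rw [mem_ball_zero_iff] at hw ⊢
    simpa [φ, hc] using norm_mobius_lt_one (z := -z) (by simpa using hz1) hw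
  have hψne {ζ : ℂ} (hζ : ζ ∈ ball (0 : ℂ) 1) : 1 - c * ζ ≠ 0 :=
    one_sub_conj_mul_ne_zero hz1 (mem_ball_zero_iff.mp hζ)
  have hone {ζ : ℂ} (hζ : ζ ∈ ball (0 : ℂ) 1) : 1 + c * ψ ζ = (1 - c * z) / (1 - c * ζ) := by
    have := hψne hζ
    simp only [ψ]
    field_simp
    ring
  have hφψ {ζ : ℂ} (hζ : ζ ∈ ball (0 : ℂ) 1) : φ (ψ ζ) = ζ := by
    have := hψne hζ
    simp only [φ]
    rw [hone hζ, div_eq_iff (div_ne_zero ha' this)]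
    simp only [ψ]
    rw [div_add' _ _ _ this, mul_div_assoc']
    congr 1
    ring
  have hφd : DifferentiableOn ℂ φ (ball 0 1) := fun w hw =>
    DifferentiableAt.differentiableWithinAt
      (DifferentiableAt.div (by fun_prop) (by fun_prop) (hφne hw))
  have hgd : DifferentiableOn ℂ (f ∘ φ) (ball 0 1) := hf.comp hφd hφ1
  have hψd : ∀ ζ ∈ ball (0 : ℂ) 1, HasDerivAt ψ ((1 + c * ψ ζ) ^ 2 / (1 - c * z)) ζ := by
    intro ζ hζ
    have hne := hψne hζ
    refine (((hasDerivAt_id ζ).sub_const z).fun_div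
      (((hasDerivAt_id ζ).const_mul c).const_sub 1) hne).congr_deriv ?_
    rw [hone hζ]
    simp only [id]
    field_simp
    ring
  have hψz : ψ z = 0 := by simp [ψ]
  have hformula := iteratedDeriv_comp_of_riccati isOpen_ball isOpen_ball hgd hψ1 hψd
    (f := f) (fun ζ hζ => by simp [hφψ hζ]) m z hz
  have hsum : ‖∑ j ∈ Finset.range (m + 1), ((m.choose j : ℂ) / (j + 1).factorial) * c ^ (m - j) *
      ((1 + c * ψ z) ^ (m + 2 + j) * iteratedDeriv (j + 1) (f ∘ φ) (ψ z))‖ ≤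
      4 * M / Real.pi * (1 + ‖z‖) ^ m := by
    rw [add_pow, Finset.mul_sum]
    refine norm_sum_le_of_le _ fun j _ => ?_
    have hco := norm_iteratedDeriv_zero_le_of_abs_re_le hgd (fun w hw => hM _ (hφ1 hw))
      (Nat.succ_ne_zero j)
    have hfac : (0 : ℝ) < (j + 1).factorial := by positivity
    rw [hψz, mul_zero, add_zero, one_pow, one_mul, one_pow, one_mul, norm_mul, norm_mul, norm_div,
      norm_pow, hc, RCLike.norm_conj, Complex.norm_natCast, Complex.norm_natCast]
    calc _ ≤ (m.choose j : ℝ) / (j + 1).factorial * ‖z‖ ^ (m - j) *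
          ((j + 1).factorial * (4 * M / Real.pi)) := by gcongr
      _ = _ := by field_simp
  have hpos : 0 < 1 - ‖z‖ := by linarith
  have hpos' : 0 < 1 + ‖z‖ := by positivity
  have hnorm : ‖1 - c * z‖ = (1 - ‖z‖) * (1 + ‖z‖) := by
    rw [hcz, ← ofReal_one, ← ofReal_sub, Complex.norm_of_nonneg (by nlinarith [norm_nonneg z])]
    ring
  rw [hformula, norm_mul, norm_div, norm_pow, hnorm, Complex.norm_natCast]
  calc _ ≤ ((m + 1).factorial : ℝ) / ((1 - ‖z‖) * (1 + ‖z‖)) ^ (m + 1) *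
        (4 * M / Real.pi * (1 + ‖z‖) ^ m) := by gcongr
    _ = _ := by
      rw [mul_pow, pow_succ (1 + ‖z‖)]
      field_simp
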